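/- Let r ≥ 2 and let A₁, …, A_r be symmetric real m×m matrices satisfying A_i² = 1ₘ for all i and A_iA_j + A_jA_i = 0 for all i ≠ j. Then m is even, say m = 2k, and there exist real k×k matrices E₁, …, E_{r−1} satisfying E_iE_iᵗ = 1ₖ and E_iᵗE_i = 1ₖ for all i, and E_iE_jᵗ + E_jE_iᵗ = 0 for all i ≠ j. -/

import Mathlib

open Matrix

/-- A symmetric idempotent real matrix factors as `U * Uᵀ` where `U` has orthonormal columns. -/
theorem Matrix.IsSymm.exists_mul_transpose_eq_of_isIdempotentElem {n : Type*} [Fintype n]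
    [DecidableEq n] {P : Matrix n n ℝ} (hP : P.IsSymm) (hidem : IsIdempotentElem P) :
    ∃ (k : ℕ) (U : Matrix n (Fin k) ℝ), Uᵀ * U = 1 ∧ U * Uᵀ = P := by
  have hH : P.IsHermitian := by
    rw [Matrix.IsHermitian, conjTranspose_eq_transpose_of_trivial, hP.eq]
  obtain ⟨V, d, hV, hspec⟩ : ∃ (V : Matrix n n ℝ) (d : n → ℝ),
      Vᵀ * V = 1 ∧ P = V * diagonal d * Vᵀ := by
    refine ⟨hH.eigenvectorUnitary, hH.eigenvalues, ?_, ?_⟩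
    · have := Unitary.coe_star_mul_self hH.eigenvectorUnitary
      rwa [star_eq_conjTranspose, conjTranspose_eq_transpose_of_trivial] at this
    · have := hH.spectral_theorem
      rw [Unitary.conjStarAlgAut_apply, star_eq_conjTranspose,
        conjTranspose_eq_transpose_of_trivial] at this
      exact this
  have hdiag : Vᵀ * P * V = diagonal d := by
    calc Vᵀ * P * V = (Vᵀ * V) * diagonal d * (Vᵀ * V) := by
          rw [hspec]; simp only [Matrix.mul_assoc]
      _ = diagonal d := by simp [hV]
  have hV' : V * Vᵀ = 1 := mul_eq_one_comm.mp hV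
  have hdd : ∀ i, d i * d i = d i := by
    have : diagonal d * diagonal d = diagonal d := by
      calc diagonal d * diagonal d = Vᵀ * P * (V * Vᵀ) * P * V := by
            nth_rewrite 1 2 [← hdiag]; simp only [Matrix.mul_assoc]
        _ = Vᵀ * (P * P) * V := by rw [hV']; simp [Matrix.mul_assoc]
        _ = diagonal d := by rw [hidem.eq, hdiag]
    rw [diagonal_mul_diagonal] at this
    exact fun i => congrFun (diagonal_injective this) i
  let e := (Fintype.equivFin {i // d i = 1}).symm
  refine ⟨_, V.submatrix id (fun j => (e j : n)), ?_, ?_⟩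
  · ext a b
    have h := congrFun (congrFun hV (e a)) (e b)
    simpa [Matrix.mul_apply, Matrix.one_apply, Subtype.ext_iff.symm] using h
  · ext a b
    rw [hspec, Matrix.mul_apply, Matrix.mul_apply]
    simp only [submatrix_apply, transpose_apply, id, mul_diagonal]
    rw [e.sum_comp (fun i : {i // d i = 1} => V a i * V b i),
      ← Finset.sum_subtype (Finset.univ.filter fun i => d i = 1) (by simp)
        (fun i => V a i * V b i), Finset.sum_filter]
    refine Finset.sum_congr rfl fun i _ => ?_
    split_ifs with h
    · simp [h]
    · have h0 : d i = 0 := by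
        have := hdd i
        by_contra h0
        exact h (mul_left_cancel₀ h0 (by rw [this, mul_one]))
      simp [h0]

/-- If `r ≥ 2` and `A₁, …, A_r` are symmetric real `m × m` matrices with `A_i² = 1ₘ`
and `A_iA_j + A_jA_i = 0` for `i ≠ j`, then `m = 2k` is even and there exist real
`k × k` matrices `E₁, …, E_{r−1}` with `E_iE_iᵗ = E_iᵗE_i = 1ₖ` and
`E_iE_jᵗ + E_jE_iᵗ = 0` for `i ≠ j`. -/
theorem symmetric_hurwitz_system_reduction (m r : ℕ) (hr : 2 ≤ r)
    (A : Fin r → Matrix (Fin m) (Fin m) ℝ)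
    (hsymm : ∀ i, (A i).IsSymm)
    (hsq : ∀ i, A i * A i = 1)
    (hanti : ∀ i j, i ≠ j → A i * A j + A j * A i = 0) :
    ∃ k : ℕ, m = 2 * k ∧
      ∃ E : Fin (r - 1) → Matrix (Fin k) (Fin k) ℝ,
        (∀ i, E i * (E i)ᵀ = 1) ∧ (∀ i, (E i)ᵀ * E i = 1) ∧
        (∀ i j, i ≠ j → E i * (E j)ᵀ + E j * (E i)ᵀ = 0) := by
  obtain ⟨s, rfl⟩ : ∃ s, r = s + 2 := ⟨r - 2, by omega⟩
  change ∃ k : ℕ, m = 2 * k ∧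
      ∃ E : Fin (s + 1) → Matrix (Fin k) (Fin k) ℝ,
        (∀ i, E i * (E i)ᵀ = 1) ∧ (∀ i, (E i)ᵀ * E i = 1) ∧
        (∀ i j, i ≠ j → E i * (E j)ᵀ + E j * (E i)ᵀ = 0)
  have hflip : ∀ i : Fin (s + 1), A i.succ * A 0 = -(A 0 * A i.succ) := fun i =>
    eq_neg_of_add_eq_zero_left (hanti _ _ (Fin.succ_ne_zero i))
  obtain ⟨k, U, hU, hUP⟩ :=
    Matrix.IsSymm.exists_mul_transpose_eq_of_isIdempotentElem
      (P := (1 / 2 : ℝ) • (1 + A 0))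
      ((isSymm_one.add (hsymm 0)).smul _)
      (by
        simp only [IsIdempotentElem, smul_mul_smul_comm, add_mul, mul_add, hsq, one_mul, mul_one]
        module)
  have htr : (A 0).trace = 0 := by
    have h1 : A (Fin.succ 0) * A 0 * A (Fin.succ 0) = -A 0 := by
      rw [hflip, neg_mul, mul_assoc, hsq, mul_one]
    have h2 := congrArg trace h1
    rw [trace_mul_comm, ← mul_assoc, hsq, one_mul, trace_neg] at h2
    linarith
  have hk : m = 2 * k := by
    have h := congrArg trace hUP
    rw [trace_mul_comm, hU] at h
    simp [trace_add, htr] at h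
    have : (m : ℝ) = 2 * k := by linarith
    exact_mod_cast this
  have hfix : Uᵀ * A 0 = Uᵀ := by
    have h : Uᵀ * (U * Uᵀ) = Uᵀ := by rw [← Matrix.mul_assoc, hU, Matrix.one_mul]
    rw [hUP, Matrix.mul_smul, Matrix.mul_add, Matrix.mul_one] at h
    calc Uᵀ * A 0 = (2 : ℝ) • ((1 / 2 : ℝ) • (Uᵀ + Uᵀ * A 0)) - Uᵀ := by module
      _ = Uᵀ := by rw [h]; module
  have hconj : ∀ i : Fin (s + 1),
      Uᵀ * A i.succ * (A (Fin.succ 0) * (U * Uᵀ) * A (Fin.succ 0)) = Uᵀ * A i.succ := by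
    intro i
    have h1 : A (Fin.succ 0) * (U * Uᵀ) * A (Fin.succ 0) = (1 / 2 : ℝ) • (1 - A 0) := by
      rw [hUP, mul_smul_comm, smul_mul_assoc, mul_add, add_mul, mul_one, hsq, hflip, neg_mul,
        mul_assoc, hsq, mul_one, sub_eq_add_neg]
    have h2 : Uᵀ * A i.succ * A 0 = -(Uᵀ * A i.succ) := by
      rw [Matrix.mul_assoc, hflip, Matrix.mul_neg, ← Matrix.mul_assoc, hfix]
    rw [h1, Matrix.mul_smul, Matrix.mul_sub, Matrix.mul_one, h2]
    module
  have hmul : ∀ i j : Fin (s + 1),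
      (Uᵀ * A i.succ * (A (Fin.succ 0) * U)) * (Uᵀ * A j.succ * (A (Fin.succ 0) * U))ᵀ =
        Uᵀ * (A i.succ * A j.succ) * U := by
    intro i j
    have h := congrArg (· * (A j.succ * U)) (hconj i)
    simp only [transpose_mul, transpose_transpose, (hsymm _).eq, Matrix.mul_assoc] at h ⊢
    exact h
  have hone : ∀ i : Fin (s + 1), (Uᵀ * A i.succ * (A (Fin.succ 0) * U)) *
      (Uᵀ * A i.succ * (A (Fin.succ 0) * U))ᵀ = 1 := fun i => by
    rw [hmul, hsq, Matrix.mul_one, hU]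
  refine ⟨k, hk, fun i => Uᵀ * A i.succ * (A (Fin.succ 0) * U), hone,
    fun i => mul_eq_one_comm.mp (hone i), fun i j hij => ?_⟩
  rw [hmul, hmul, ← Matrix.add_mul, ← Matrix.mul_add,
    hanti _ _ (fun h => hij (Fin.succ_injective _ h)), Matrix.mul_zero, Matrix.zero_mul]
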